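/- (Invariant density of the Stochastic Bouncy Hybrid Sampler.) Let U : ℝ^d → ℝ be continuously differentiable with ∫ e^{-U(x)} dx < ∞, and let g : ℝ^d → ℝ^d be continuous with g(x) ≠ 0 for all x. For each x, write ĝ(x) = g(x)/‖g(x)‖, P_∥(x) v = ⟨v, ĝ(x)⟩ ĝ(x), and P_⊥(x) v = v - P_∥(x) v. Then for every smooth compactly supported f : ℝ^d × ℝ^d → ℝ, ∫∫ [ ⟨∇_x f(x,v), v⟩ + ⟨∇_v f(x,v), -∇U(x) + g(x)⟩ + max{0, ⟨v, g(x)⟩} ( ∫ f(x, -P_∥(x) v + P_⊥(x) ξ) ψ_d(ξ) dξ - f(x,v) ) ] e^{-U(x)} ψ_d(v) dx dv = 0. -/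

import Mathlib

open scoped InnerProductSpace
open MeasureTheory

/-- The standard Gaussian density on `ℝ^d`. -/
noncomputable def gaussDensity (d : ℕ) (v : EuclideanSpace ℝ (Fin d)) : ℝ :=
  (2 * Real.pi) ^ (-(d : ℝ) / 2) * Real.exp (-‖v‖ ^ 2 / 2)

section Slices

variable {X Y α : Type*} [TopologicalSpace X] [TopologicalSpace Y] [Zero α]

lemma HasCompactSupport.slice_left [T2Space Y] {f : X × Y → α} (hf : HasCompactSupport f) (x : X) :
    HasCompactSupport (fun y => f (x, y)) :=
  .intro (hf.isCompact.image continuous_snd) fun y hy => image_eq_zero_of_notMem_tsupport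
    fun h => hy ⟨(x, y), h, rfl⟩

lemma HasCompactSupport.slice_right [T2Space X] {f : X × Y → α} (hf : HasCompactSupport f) (y : Y) :
    HasCompactSupport (fun x => f (x, y)) :=
  .intro (hf.isCompact.image continuous_fst) fun x hx => image_eq_zero_of_notMem_tsupport
    fun h => hx ⟨(x, y), h, rfl⟩

end Slices

section Gaussian

variable {d : ℕ}

local notation "𝔼" => EuclideanSpace ℝ (Fin d)

lemma contDiff_gaussDensity : ContDiff ℝ 1 (gaussDensity d) := by
  unfold gaussDensity
  have : ContDiff ℝ 1 (fun v : 𝔼 => ‖v‖ ^ 2) := contDiff_norm_sq ℝ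
  fun_prop

lemma fderiv_gaussDensity (v w : 𝔼) :
    fderiv ℝ (gaussDensity d) v w = -⟪v, w⟫_ℝ * gaussDensity d v := by
  have h : HasFDerivAt (fun v : 𝔼 => ‖v‖ ^ 2) (2 • innerSL ℝ v) v :=
    (hasStrictFDerivAt_norm_sq v).hasFDerivAt
  have h' : HasFDerivAt (gaussDensity d) _ v :=
    (((h.neg.mul_const (2⁻¹ : ℝ)).exp).const_mul ((2 * Real.pi) ^ (-(d : ℝ) / 2)))
  rw [h'.fderiv]
  simp [gaussDensity, div_eq_mul_inv]
  ring

lemma integral_gaussDensity : ∫ v : 𝔼, gaussDensity d v = 1 := by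
  have h := GaussianFourier.integral_rexp_neg_mul_sq_norm (V := 𝔼) (b := 1 / 2) (by norm_num)
  have e : ∀ v : 𝔼, -‖v‖ ^ 2 / 2 = -(1 / 2) * ‖v‖ ^ 2 := fun v => by ring
  simp only [gaussDensity, e]
  rw [integral_const_mul, h, finrank_euclideanSpace_fin, neg_div,
    Real.rpow_neg (by positivity), div_div_eq_mul_div, div_one, mul_comm Real.pi]
  exact inv_mul_cancel₀ (by positivity)

lemma integrable_gaussDensity : Integrable (gaussDensity d) :=
  .of_integral_ne_zero (by simp [integral_gaussDensity])

lemma gaussDensity_mul_gaussDensity {v w v' w' : 𝔼}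
    (h : ‖v‖ ^ 2 + ‖w‖ ^ 2 = ‖v'‖ ^ 2 + ‖w'‖ ^ 2) :
    gaussDensity d v * gaussDensity d w = gaussDensity d v' * gaussDensity d w' := by
  simp only [gaussDensity]
  rw [mul_mul_mul_comm, mul_mul_mul_comm _ (Real.exp (-‖v'‖ ^ 2 / 2)), ← Real.exp_add,
    ← Real.exp_add]
  congr 2
  linarith

end Gaussian

section IntegrationByParts

variable {E : Type*} [NormedAddCommGroup E] [NormedSpace ℝ E] [MeasurableSpace E]
  [BorelSpace E] {μ : Measure E} [μ.IsAddHaarMeasure]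

lemma integrable_fderiv_mul_of_hasCompactSupport {F u : E → ℝ} (hF : ContDiff ℝ 1 F)
    (hFc : HasCompactSupport F) (hu : Continuous u) (w : E) :
    Integrable (fun x => fderiv ℝ F x w * u x) μ :=
  (((hF.continuous_fderiv one_ne_zero).clm_apply continuous_const).mul
    hu).integrable_of_hasCompactSupport (((hFc.fderiv ℝ).comp_left
      (g := fun L : E →L[ℝ] ℝ => L w) rfl).mul_right)

lemma integral_fderiv_mul_of_hasCompactSupport [FiniteDimensional ℝ E] {F u : E → ℝ}
    (hF : ContDiff ℝ 1 F)
    (hFc : HasCompactSupport F) (hu : ContDiff ℝ 1 u) (w : E) :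
    ∫ x, fderiv ℝ F x w * u x ∂μ = -∫ x, F x * fderiv ℝ u x w ∂μ := by
  rw [integral_mul_fderiv_eq_neg_fderiv_mul_of_integrable, neg_neg]
  · exact integrable_fderiv_mul_of_hasCompactSupport hF hFc hu.continuous w
  · exact (hF.continuous.mul ((hu.continuous_fderiv one_ne_zero).clm_apply
      continuous_const)).integrable_of_hasCompactSupport hFc.mul_right
  · exact (hF.continuous.mul hu.continuous).integrable_of_hasCompactSupport hFc.mul_right
  · exact fun x _ => hF.differentiable one_ne_zero x
  · exact fun x _ => hu.differentiable one_ne_zero x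

end IntegrationByParts

section Bounce

variable {E : Type*} [NormedAddCommGroup E] [InnerProductSpace ℝ E]

/-- The involution `(v, ξ) ↦ (-v∥ + ξ⊥, v⊥ - ξ∥)` of `E × E`, where `∥` and `⊥` denote the
components parallel and orthogonal to the unit vector `n`. -/
noncomputable def bounceMap (n : E) : E × E →L[ℝ] E × E :=
  let P : E →L[ℝ] E := (innerSL ℝ n).smulRight n
  let v := ContinuousLinearMap.fst ℝ E E
  let ξ := ContinuousLinearMap.snd ℝ E E
  (-(P ∘L v) + (ξ - P ∘L ξ)).prod ((v - P ∘L v) - P ∘L ξ)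

lemma bounceMap_apply (n : E) (p : E × E) :
    bounceMap n p = (-(⟪p.1, n⟫_ℝ • n) + (p.2 - ⟪p.2, n⟫_ℝ • n),
      p.1 - ⟪p.1, n⟫_ℝ • n - ⟪p.2, n⟫_ℝ • n) := by
  simp [bounceMap, real_inner_comm]

variable {n : E} (hn : ‖n‖ = 1)
include hn

lemma inner_fst_bounceMap (p : E × E) : ⟪(bounceMap n p).1, n⟫_ℝ = -⟪p.1, n⟫_ℝ := by
  simp [bounceMap_apply, inner_add_left, inner_sub_left, inner_smul_left, hn]

lemma inner_snd_bounceMap (p : E × E) : ⟪(bounceMap n p).2, n⟫_ℝ = -⟪p.2, n⟫_ℝ := by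
  simp [bounceMap_apply, inner_sub_left, inner_smul_left, hn]

lemma bounceMap_bounceMap (p : E × E) : bounceMap n (bounceMap n p) = p := by
  rw [bounceMap_apply, inner_fst_bounceMap hn, inner_snd_bounceMap hn, bounceMap_apply]
  ext1 <;> module

lemma norm_sq_bounceMap (p : E × E) :
    ‖(bounceMap n p).1‖ ^ 2 + ‖(bounceMap n p).2‖ ^ 2 = ‖p.1‖ ^ 2 + ‖p.2‖ ^ 2 := by
  simp only [bounceMap_apply, ← real_inner_self_eq_norm_sq, inner_add_left, inner_sub_left,
    inner_smul_left, inner_add_right, inner_sub_right, inner_smul_right, inner_neg_left,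
    inner_neg_right, real_inner_comm n, real_inner_self_eq_norm_sq n, hn]
  simp
  ring

lemma measurePreserving_bounceMap [FiniteDimensional ℝ E] [MeasurableSpace E] [BorelSpace E]
    (μ : Measure (E × E)) [μ.IsAddHaarMeasure] : MeasurePreserving (bounceMap n) μ μ := by
  refine ⟨(bounceMap n).continuous.measurable, ?_⟩
  have hsq : (bounceMap n : E × E →ₗ[ℝ] E × E) ∘ₗ (bounceMap n : E × E →ₗ[ℝ] E × E) = .id :=
    LinearMap.ext fun p => bounceMap_bounceMap hn p
  have hdet := congrArg LinearMap.det hsq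
  rw [LinearMap.det_comp, LinearMap.det_id] at hdet
  have habs : |LinearMap.det (bounceMap n : E × E →ₗ[ℝ] E × E)| = 1 :=
    (abs_eq zero_le_one).2 (mul_self_eq_one_iff.1 hdet)
  have h := Measure.map_linearMap_addHaar_eq_smul_addHaar μ
    (f := (bounceMap n : E × E →ₗ[ℝ] E × E)) (left_ne_zero_of_mul_eq_one hdet)
  rw [abs_inv, habs] at h
  simpa using h

lemma measurableEmbedding_bounceMap [FiniteDimensional ℝ E] [MeasurableSpace E] [BorelSpace E] :
    MeasurableEmbedding (bounceMap n) :=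
  (Homeomorph.mk ⟨bounceMap n, bounceMap n, bounceMap_bounceMap hn, bounceMap_bounceMap hn⟩
    (bounceMap n).continuous (bounceMap n).continuous).measurableEmbedding

end Bounce

section Velocity

variable {d : ℕ}

local notation "𝔼" => EuclideanSpace ℝ (Fin d)

lemma integrable_mul_gaussDensity {F k : 𝔼 → ℝ} (hF : Continuous F) (hFc : HasCompactSupport F)
    (hk : Continuous k) : Integrable (fun v => k v * F v * gaussDensity d v) :=
  ((hk.mul hF).mul contDiff_gaussDensity.continuous).integrable_of_hasCompactSupport
    hFc.mul_left.mul_right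

/-- The gain term of the stochastic bounce: under the Gaussian law, the bounced velocity is again
Gaussian, with opposite component along `n`. -/
lemma integral_bounce {F k : 𝔼 → ℝ} {κ : ℝ → ℝ} (hF : Continuous F) (hFc : HasCompactSupport F)
    (hκ : Continuous κ) {n : 𝔼} (hn : ‖n‖ = 1) (hk : ∀ v, k v = κ ⟪v, n⟫_ℝ) :
    Integrable (fun v => k v * (∫ ξ, F (-(⟪v, n⟫_ℝ • n) + (ξ - ⟪ξ, n⟫_ℝ • n))
      * gaussDensity d ξ) * gaussDensity d v) ∧
    ∫ v, k v * (∫ ξ, F (-(⟪v, n⟫_ℝ • n) + (ξ - ⟪ξ, n⟫_ℝ • n)) * gaussDensity d ξ)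
        * gaussDensity d v
      = ∫ w, κ (-⟪w, n⟫_ℝ) * F w * gaussDensity d w := by
  let h : 𝔼 × 𝔼 → ℝ := fun p => (κ (-⟪p.1, n⟫_ℝ) * F p.1 * gaussDensity d p.1) * gaussDensity d p.2
  have hh : Integrable h (volume.prod volume) :=
    (integrable_mul_gaussDensity (k := fun w => κ (-⟪w, n⟫_ℝ)) hF hFc (by fun_prop)).mul_prod
      integrable_gaussDensity
  have hmp := measurePreserving_bounceMap hn ((volume : Measure 𝔼).prod (volume : Measure 𝔼))
  have hcomp : Integrable (h ∘ bounceMap n) (volume.prod volume) :=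
    (hmp.integrable_comp_emb (measurableEmbedding_bounceMap hn)).2 hh
  have hinner : ∀ v, ∫ ξ, (h ∘ bounceMap n) (v, ξ)
      = k v * (∫ ξ, F (-(⟪v, n⟫_ℝ • n) + (ξ - ⟪ξ, n⟫_ℝ • n)) * gaussDensity d ξ)
        * gaussDensity d v := by
    intro v
    rw [← integral_const_mul, ← integral_mul_const]
    refine integral_congr_ae (.of_forall fun ξ => ?_)
    have hg := gaussDensity_mul_gaussDensity (norm_sq_bounceMap hn (v, ξ))
    simp only [h, Function.comp_apply, mul_assoc, hg, inner_fst_bounceMap hn, neg_neg, hk]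
    rw [bounceMap_apply]
    ring
  have e := hcomp.integral_prod_left
  simp only [hinner] at e
  refine ⟨e, ?_⟩
  calc _ = ∫ p, h (bounceMap n p) ∂(volume.prod volume) := by
        rw [← integral_congr_ae (.of_forall hinner)]
        exact (integral_prod _ hcomp).symm
    _ = ∫ p, h p ∂(volume.prod volume) := hmp.integral_comp (measurableEmbedding_bounceMap hn) h
    _ = _ := by
        rw [integral_prod_mul (fun w => κ (-⟪w, n⟫_ℝ) * F w * gaussDensity d w) (gaussDensity d),
          integral_gaussDensity, mul_one]

/-- Adjoint identity for the part of the generator acting on the velocity only. -/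
lemma integral_velocity_generator {F : 𝔼 → ℝ} (hF : ContDiff ℝ 1 F) (hFc : HasCompactSupport F)
    {a : 𝔼} (ha : a ≠ 0) (p n : 𝔼) (hn : n = ‖a‖⁻¹ • a) :
    Integrable (fun v => (fderiv ℝ F v (-p + a) + max 0 ⟪v, a⟫_ℝ
      * ((∫ ξ, F (-(⟪v, n⟫_ℝ • n) + (ξ - ⟪ξ, n⟫_ℝ • n)) * gaussDensity d ξ) - F v))
      * gaussDensity d v) ∧
    ∫ v, (fderiv ℝ F v (-p + a) + max 0 ⟪v, a⟫_ℝ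
      * ((∫ ξ, F (-(⟪v, n⟫_ℝ • n) + (ξ - ⟪ξ, n⟫_ℝ • n)) * gaussDensity d ξ) - F v))
      * gaussDensity d v = ∫ v, -⟪v, p⟫_ℝ * F v * gaussDensity d v := by
  have ha' : ‖a‖ ≠ 0 := norm_ne_zero_iff.2 ha
  have hn1 : ‖n‖ = 1 := by rw [hn, norm_smul, norm_inv, norm_norm, inv_mul_cancel₀ ha']
  have han : ∀ v, ⟪v, a⟫_ℝ = ‖a‖ * ⟪v, n⟫_ℝ := fun v => by
    rw [hn, inner_smul_right, mul_inv_cancel_left₀ ha']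
  obtain ⟨hgain, hgain_eq⟩ := integral_bounce hF.continuous hFc (k := fun v => max 0 ⟪v, a⟫_ℝ)
    (κ := fun t => max 0 (‖a‖ * t)) (by fun_prop) hn1 (fun v => by rw [han])
  have hloss := integrable_mul_gaussDensity (k := fun v => max 0 ⟪v, a⟫_ℝ) hF.continuous hFc
    (by fun_prop)
  have hgain' := integrable_mul_gaussDensity (k := fun v => max 0 (‖a‖ * -⟪v, n⟫_ℝ))
    hF.continuous hFc (by fun_prop)
  have hdrift := integrable_fderiv_mul_of_hasCompactSupport (μ := volume) hF hFc
    contDiff_gaussDensity.continuous (-p + a)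
  have hdrift' := integrable_mul_gaussDensity (k := fun v => ⟪v, -p + a⟫_ℝ)
    hF.continuous hFc (by fun_prop)
  have hdrift_eq := integral_fderiv_mul_of_hasCompactSupport (μ := volume) hF hFc
    contDiff_gaussDensity (-p + a)
  rw [← integral_neg] at hdrift_eq
  have hsum := (hdrift.add hgain).sub hloss
  constructor
  · refine hsum.congr (.of_forall fun v => ?_)
    simp only [Pi.add_apply, Pi.sub_apply]
    ring
  · calc _ = ∫ v, ((fderiv ℝ F v (-p + a) * gaussDensity d v
            + max 0 ⟪v, a⟫_ℝ * (∫ ξ, F (-(⟪v, n⟫_ℝ • n) + (ξ - ⟪ξ, n⟫_ℝ • n))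
              * gaussDensity d ξ) * gaussDensity d v)
            - max 0 ⟪v, a⟫_ℝ * F v * gaussDensity d v) := by
          congr with v
          ring
      _ = ∫ v, ((⟪v, -p + a⟫_ℝ * F v * gaussDensity d v
            + max 0 (‖a‖ * -⟪v, n⟫_ℝ) * F v * gaussDensity d v)
            - max 0 ⟪v, a⟫_ℝ * F v * gaussDensity d v) := by
          rw [integral_sub (by exact hdrift.add hgain) hloss, integral_add hdrift hgain, hgain_eq,
            hdrift_eq, integral_sub (by exact hdrift'.add hgain') hloss,
            integral_add hdrift' hgain']
          congr! 4 with v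
          rw [fderiv_gaussDensity]
          ring
      _ = _ := by
          congr with v
          have hmax : max 0 (‖a‖ * -⟪v, n⟫_ℝ) - max 0 ⟪v, a⟫_ℝ = -⟪v, a⟫_ℝ := by
            rw [mul_neg, ← han]
            rcases le_total 0 ⟪v, a⟫_ℝ with h | h
            · rw [max_eq_left (neg_nonpos.2 h), max_eq_right h, zero_sub]
            · rw [max_eq_right (neg_nonneg.2 h), max_eq_left h, sub_zero]
          rw [inner_add_right, inner_neg_right]
          linear_combination F v * gaussDensity d v * hmax

end Velocity

/-- Invariant density of the Stochastic Bouncy Hybrid Sampler: the integral of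
its infinitesimal generator against `ρ(x,v) ∝ e^{-U(x)} ψ_d(v)` vanishes. -/
theorem stmt_7 {d : ℕ} (U : EuclideanSpace ℝ (Fin d) → ℝ) (hU : ContDiff ℝ 1 U)
    (hUint : Integrable (fun x => Real.exp (-U x)))
    (g : EuclideanSpace ℝ (Fin d) → EuclideanSpace ℝ (Fin d)) (hg : Continuous g)
    (hg0 : ∀ x, g x ≠ 0)
    (ghat : EuclideanSpace ℝ (Fin d) → EuclideanSpace ℝ (Fin d))
    (hghat : ∀ x, ghat x = ‖g x‖⁻¹ • g x)
    (Ppar Pperp : EuclideanSpace ℝ (Fin d) → EuclideanSpace ℝ (Fin d) → EuclideanSpace ℝ (Fin d))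
    (hPpar : ∀ x v, Ppar x v = ⟪v, ghat x⟫_ℝ • ghat x)
    (hPperp : ∀ x v, Pperp x v = v - Ppar x v)
    (f : EuclideanSpace ℝ (Fin d) × EuclideanSpace ℝ (Fin d) → ℝ)
    (hf : ContDiff ℝ (⊤ : ℕ∞) f) (hfc : HasCompactSupport f) :
    ∫ x, ∫ v,
        (⟪gradient (fun y => f (y, v)) x, v⟫_ℝ
          + ⟪gradient (fun w => f (x, w)) v, -gradient U x + g x⟫_ℝ
          + max 0 ⟪v, g x⟫_ℝ
            * ((∫ ξ, f (x, -Ppar x v + Pperp x ξ) * gaussDensity d ξ) - f (x, v)))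
        * (Real.exp (-U x) * gaussDensity d v) = 0 := by
  have hf1 : ContDiff ℝ 1 f := hf.of_le (by exact_mod_cast le_top)
  have hfx : ∀ v, ContDiff ℝ 1 (fun y => f (y, v)) := fun v => by fun_prop
  have hfv : ∀ x, ContDiff ℝ 1 (fun w => f (x, w)) := fun x => by fun_prop
  have hfd : ∀ x v w, fderiv ℝ (fun y => f (y, v)) x w = fderiv ℝ f (x, v) (w, 0) := by
    intro x v w
    have h := ((hf1.differentiable one_ne_zero (x, v)).hasFDerivAt.comp (f := fun y => (y, v)) x
      (hasFDerivAt_prodMk_left x v)).fderiv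
    change fderiv ℝ (fun y => f (y, v)) x = _ at h
    simp [h]
  have hE : ContDiff ℝ 1 (fun x => Real.exp (-U x)) := by fun_prop
  have hEd : ∀ x w, fderiv ℝ (fun x => Real.exp (-U x)) x w
      = -fderiv ℝ U x w * Real.exp (-U x) := by
    intro x w
    have h := (hU.differentiable one_ne_zero x).hasFDerivAt.neg.exp.fderiv
    change fderiv ℝ (fun x => Real.exp (-U x)) x = _ at h
    simp [h, mul_comm]
  have hψ := (contDiff_gaussDensity (d := d)).continuous
  have hE' := hE.continuous
  have hU' := hU.continuous_fderiv one_ne_zero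
  have hf' := hf1.continuous_fderiv one_ne_zero
  let T : EuclideanSpace ℝ (Fin d) → EuclideanSpace ℝ (Fin d) → ℝ := fun x v =>
    (fderiv ℝ f (x, v) (v, 0) - f (x, v) * fderiv ℝ U x v) * (Real.exp (-U x) * gaussDensity d v)
  have hTcont : Continuous (Function.uncurry T) := by
    have hf0 := hf1.continuous
    simp only [T, Function.uncurry_def]
    fun_prop
  have hTc : HasCompactSupport (Function.uncurry T) := by
    refine hfc.mono' fun p hp => ?_
    by_contra hpf
    apply hp
    simp [T, Function.uncurry, image_eq_zero_of_notMem_tsupport hpf,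
      fderiv_of_notMem_tsupport (𝕜 := ℝ) hpf]
  have hTint : Integrable (Function.uncurry T) (volume.prod volume) :=
    hTcont.integrable_of_hasCompactSupport hTc
  have hinner : ∀ x, ∫ v,
        (⟪gradient (fun y => f (y, v)) x, v⟫_ℝ
          + ⟪gradient (fun w => f (x, w)) v, -gradient U x + g x⟫_ℝ
          + max 0 ⟪v, g x⟫_ℝ
            * ((∫ ξ, f (x, -Ppar x v + Pperp x ξ) * gaussDensity d ξ) - f (x, v)))
        * (Real.exp (-U x) * gaussDensity d v) = ∫ v, T x v := by
    intro x
    obtain ⟨hvel, hvel_eq⟩ := integral_velocity_generator (hfv x) (hfc.slice_left x) (hg0 x)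
      (gradient U x) (ghat x) (hghat x)
    have htrans : Integrable (fun v => fderiv ℝ f (x, v) (v, 0) * gaussDensity d v) := by
      refine Continuous.integrable_of_hasCompactSupport (by fun_prop) ?_
      refine HasCompactSupport.mul_right (HasCompactSupport.slice_left
        (f := fun p => fderiv ℝ f p (p.2, 0)) ?_ x)
      refine (hfc.fderiv ℝ).mono fun p hp hp' => hp ?_
      simp [hp']
    have hpot := integrable_mul_gaussDensity (k := fun v => -⟪v, gradient U x⟫_ℝ)
      (hfv x).continuous (hfc.slice_left x) (by fun_prop)
    have hsplit := integral_add htrans hvel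
    rw [hvel_eq, ← integral_add htrans hpot] at hsplit
    simp only [hPperp, hPpar, inner_gradient_left, hfd, T]
    calc _ = Real.exp (-U x) * ∫ v, (fderiv ℝ f (x, v) (v, 0) * gaussDensity d v
            + -⟪v, gradient U x⟫_ℝ * f (x, v) * gaussDensity d v) := by
          rw [← hsplit, ← integral_const_mul]
          congr with v
          ring
      _ = _ := by
          rw [← integral_const_mul]
          congr with v
          rw [← inner_gradient_left (f := U), real_inner_comm]
          ring
  simp only [hinner]
  rw [integral_integral_swap hTint]
  refine integral_eq_zero_of_ae (.of_forall fun v => ?_)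
  have hparts := integral_fderiv_mul_of_hasCompactSupport (μ := volume) (hfx v)
    (hfc.slice_right v) hE v
  have hd := integrable_fderiv_mul_of_hasCompactSupport (μ := volume) (hfx v)
    (hfc.slice_right v) hE' v
  have hd' : Integrable (fun x => f (x, v) * fderiv ℝ (fun x => Real.exp (-U x)) x v) :=
    (((hfx v).continuous.mul ((hE.continuous_fderiv one_ne_zero).clm_apply
      continuous_const)).integrable_of_hasCompactSupport (hfc.slice_right v).mul_right)
  rw [eq_neg_iff_add_eq_zero, ← integral_add hd hd'] at hparts
  calc ∫ x, T x v = gaussDensity d v * ∫ x, (fderiv ℝ (fun y => f (y, v)) x v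
        * Real.exp (-U x) + f (x, v) * fderiv ℝ (fun x => Real.exp (-U x)) x v) := by
        rw [← integral_const_mul]
        congr with x
        simp only [T, hfd, hEd]
        ring
    _ = 0 := by rw [hparts, mul_zero]
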